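/- Let n ∈ ℕ, 1 < p < ∞, and λ > -n/p. Then for every continuously differentiable function u : ℝⁿ → ℝ that vanishes outside some ball B_R (R > 0), one has (∫_{ℝⁿ} |u(x)|^p |x|^{λp} dx)^{1/p} ≤ (p/(λ + n/p)) (∫_{ℝⁿ} ‖Du(x)‖^p |x|^{(λ+1)p} dx)^{1/p}. -/

import Mathlib

open MeasureTheory

open Set Module
open scoped ENNReal

lemma lintegral_Ioi_one_rpow_neg {s : ℝ} (hs : 1 < s) :
    ∫⁻ t in Ioi (1 : ℝ), ENNReal.ofReal (t ^ (-s)) = ENNReal.ofReal (1 / (s - 1)) := by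
  rw [← ofReal_integral_eq_lintegral_ofReal
    (integrableOn_Ioi_rpow_of_lt (by linarith) one_pos),
    integral_Ioi_rpow_of_lt (by linarith) one_pos]
  · rw [Real.one_rpow, neg_div, ← div_neg]
    congr 2
    ring
  · filter_upwards [ae_restrict_mem measurableSet_Ioi] with t ht
    exact Real.rpow_nonneg (zero_le_one.trans (le_of_lt ht)) _

/-- Hölder's inequality on `(1, ∞)` against the weight `t ^ (-s)`. -/
lemma lintegral_Ioi_one_rpow_le {p s : ℝ} (hp : 1 < p) (hs : 1 < s) {g : ℝ → ℝ≥0∞}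
    (hg : Measurable g) :
    (∫⁻ t in Ioi (1 : ℝ), g t) ^ p ≤ ENNReal.ofReal (1 / (s - 1)) ^ (p - 1) *
      ∫⁻ t in Ioi (1 : ℝ), ENNReal.ofReal (t ^ (s * (p - 1))) * g t ^ p := by
  have hp0 : 0 < p := by linarith
  have hpq : p.HolderConjugate (p / (p - 1)) := Real.HolderConjugate.conjExponent hp
  set q := p / (p - 1) with hq
  have hp1 : p - 1 ≠ 0 := by linarith
  have hq0 : q ≠ 0 := hpq.symm.ne_zero
  have key := ENNReal.lintegral_mul_le_Lp_mul_Lq (volume.restrict (Ioi (1 : ℝ))) hpq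
    (f := fun t ↦ ENNReal.ofReal (t ^ (s / q)) * g t)
    (g := fun t ↦ ENNReal.ofReal (t ^ (-(s / q)))) (by fun_prop) (by fun_prop)
  have h1 : ∫⁻ t in Ioi (1 : ℝ), g t = ∫⁻ t in Ioi (1 : ℝ),
      ((fun t ↦ ENNReal.ofReal (t ^ (s / q)) * g t) *
        fun t ↦ ENNReal.ofReal (t ^ (-(s / q)))) t := by
    refine setLIntegral_congr_fun measurableSet_Ioi fun t ht ↦ ?_
    have ht0 : 0 < t := zero_lt_one.trans ht
    simp only [Pi.mul_apply]
    rw [mul_right_comm, ← ENNReal.ofReal_mul (by positivity), ← Real.rpow_add ht0]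
    simp
  have h2 : ∫⁻ t in Ioi (1 : ℝ), (ENNReal.ofReal (t ^ (s / q)) * g t) ^ p =
      ∫⁻ t in Ioi (1 : ℝ), ENNReal.ofReal (t ^ (s * (p - 1))) * g t ^ p := by
    refine setLIntegral_congr_fun measurableSet_Ioi fun t ht ↦ ?_
    have ht0 : 0 < t := zero_lt_one.trans ht
    rw [ENNReal.mul_rpow_of_nonneg _ _ hp0.le,
      ENNReal.ofReal_rpow_of_nonneg (by positivity) hp0.le, ← Real.rpow_mul ht0.le]
    congr 3
    rw [hq]
    field_simp
  have h3 : ∫⁻ t in Ioi (1 : ℝ), ENNReal.ofReal (t ^ (-(s / q))) ^ q =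
      ENNReal.ofReal (1 / (s - 1)) := by
    rw [← lintegral_Ioi_one_rpow_neg hs]
    refine setLIntegral_congr_fun measurableSet_Ioi fun t ht ↦ ?_
    have ht0 : 0 < t := zero_lt_one.trans ht
    rw [ENNReal.ofReal_rpow_of_nonneg (by positivity) hpq.symm.nonneg, ← Real.rpow_mul ht0.le]
    congr 2
    field_simp
  rw [← h1, h2, h3] at key
  refine (ENNReal.rpow_le_rpow key hp0.le).trans_eq ?_
  rw [ENNReal.mul_rpow_of_nonneg _ _ hp0.le, ← ENNReal.rpow_mul, ← ENNReal.rpow_mul,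
    one_div_mul_cancel hp0.ne', ENNReal.rpow_one, mul_comm]
  congr 2
  rw [hq]
  field_simp

/-- The value of a function with bounded support is controlled by its radial derivatives. -/
lemma enorm_le_lintegral_fderiv_ray {E : Type*} [NormedAddCommGroup E] [NormedSpace ℝ E]
    {u : E → ℝ} (hu : ContDiff ℝ 1 u) {R : ℝ}
    (hsupp : ∀ x, x ∉ Metric.ball (0 : E) R → u x = 0) {x : E} (hx : x ≠ 0) :
    ‖u x‖ₑ ≤ ∫⁻ t in Ioi (1 : ℝ), ENNReal.ofReal (‖fderiv ℝ u (t • x)‖ * ‖x‖) := by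
  have hx0 : 0 < ‖x‖ := norm_pos_iff.2 hx
  obtain ⟨T, hT1, hTR⟩ : ∃ T : ℝ, 1 ≤ T ∧ R ≤ T * ‖x‖ :=
    ⟨max 1 (R / ‖x‖), le_max_left _ _, (div_le_iff₀ hx0).1 (le_max_right _ _)⟩
  have huT : u (T • x) = 0 := by
    apply hsupp
    rw [mem_ball_zero_iff, norm_smul, Real.norm_of_nonneg (by linarith)]
    exact hTR.not_gt
  have hderiv (t : ℝ) : HasDerivAt (fun t : ℝ ↦ u (t • x)) (fderiv ℝ u (t • x) x) t := by
    have h := ((hu.differentiable one_ne_zero) (t • x)).hasFDerivAt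
    have h' := h.comp_hasDerivAt t ((hasDerivAt_id t).smul_const x)
    rwa [one_smul] at h'
  have hcont : Continuous fun t : ℝ ↦ fderiv ℝ u (t • x) x := by
    have := hu.continuous_fderiv one_ne_zero
    fun_prop
  have hint := intervalIntegral.integral_eq_sub_of_hasDerivAt (a := 1) (b := T)
    (fun t _ ↦ hderiv t) (hcont.intervalIntegrable _ _)
  simp only [huT, one_smul, zero_sub] at hint
  rw [← enorm_neg, ← hint, intervalIntegral.integral_of_le hT1]
  refine (enorm_integral_le_lintegral_enorm _).trans
    ((lintegral_mono_set Ioc_subset_Ioi_self).trans (lintegral_mono fun t ↦ ?_))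
  rw [← ofReal_norm]
  exact ENNReal.ofReal_le_ofReal (ContinuousLinearMap.le_opNorm _ _)

section Haar

variable {E : Type*} [NormedAddCommGroup E] [NormedSpace ℝ E] [FiniteDimensional ℝ E]
  [MeasurableSpace E] [BorelSpace E] (μ : Measure E) [μ.IsAddHaarMeasure]

lemma lintegral_comp_pos_smul {f : E → ℝ≥0∞} (hf : Measurable f) {t : ℝ} (ht : 0 < t) :
    ∫⁻ x, f (t • x) ∂μ = ENNReal.ofReal (t ^ (-(finrank ℝ E : ℝ))) * ∫⁻ x, f x ∂μ := by
  rw [← lintegral_map hf (measurable_const_smul t), Measure.map_addHaar_smul μ ht.ne',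
    lintegral_smul_measure, abs_of_pos (by positivity), Real.rpow_neg ht.le, Real.rpow_natCast,
    smul_eq_mul]

/-- Hardy's inequality, with its sharp constant, for lower Lebesgue integrals. -/
lemma lintegral_hardy_inequality [Nontrivial E] {p lam : ℝ} (hp : 1 < p)
    (hlam : 0 < lam + finrank ℝ E / p) {u : E → ℝ} (hu : ContDiff ℝ 1 u) {R : ℝ}
    (hsupp : ∀ x, x ∉ Metric.ball (0 : E) R → u x = 0) :
    ∫⁻ x, ENNReal.ofReal (|u x| ^ p * ‖x‖ ^ (lam * p)) ∂μ ≤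
      ENNReal.ofReal (1 / (lam + finrank ℝ E / p)) ^ p *
        ∫⁻ x, ENNReal.ofReal (‖fderiv ℝ u x‖ ^ p * ‖x‖ ^ ((lam + 1) * p)) ∂μ := by
  have hp0 : 0 < p := by linarith
  set s := lam + finrank ℝ E / p + 1 with hs
  have hs1 : 1 < s := by linarith
  have hss : lam + finrank ℝ E / p = s - 1 := by ring
  rw [hss]
  have hcont := hu.continuous_fderiv one_ne_zero
  have hmeas : Measurable fun x ↦ ‖fderiv ℝ u x‖ := hcont.norm.measurable
  set G : E → ℝ≥0∞ := fun x ↦ ENNReal.ofReal (‖fderiv ℝ u x‖ ^ p * ‖x‖ ^ ((lam + 1) * p))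
  have hG : Measurable G := by fun_prop
  set C := ENNReal.ofReal (1 / (s - 1))
  have hpt : ∀ᵐ x ∂μ, ENNReal.ofReal (|u x| ^ p * ‖x‖ ^ (lam * p)) ≤
      C ^ (p - 1) * ∫⁻ t in Ioi (1 : ℝ),
        ENNReal.ofReal (t ^ (s * (p - 1) - (lam + 1) * p)) * G (t • x) := by
    filter_upwards [compl_mem_ae_iff.2 (measure_singleton (μ := μ) (0 : E))] with x hx
    have hx : x ≠ 0 := hx
    have hx0 : 0 < ‖x‖ := norm_pos_iff.2 hx
    have hexp : ‖x‖ ^ ((lam + 1) * p) = ‖x‖ ^ (lam * p) * ‖x‖ ^ p := by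
      rw [← Real.rpow_add hx0, add_mul, one_mul]
    have hray : Measurable fun t : ℝ ↦ ENNReal.ofReal (‖fderiv ℝ u (t • x)‖ * ‖x‖) := by
      have : Continuous fun t : ℝ ↦ ‖fderiv ℝ u (t • x)‖ * ‖x‖ := by fun_prop
      exact this.measurable.ennreal_ofReal
    calc ENNReal.ofReal (|u x| ^ p * ‖x‖ ^ (lam * p))
        = ‖u x‖ₑ ^ p * ENNReal.ofReal (‖x‖ ^ (lam * p)) := by
          rw [ENNReal.ofReal_mul (by positivity), ← Real.norm_eq_abs,
            ← ENNReal.ofReal_rpow_of_nonneg (norm_nonneg _) hp0.le, ofReal_norm]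
      _ ≤ (C ^ (p - 1) * ∫⁻ t in Ioi (1 : ℝ), ENNReal.ofReal (t ^ (s * (p - 1))) *
            ENNReal.ofReal (‖fderiv ℝ u (t • x)‖ * ‖x‖) ^ p) *
              ENNReal.ofReal (‖x‖ ^ (lam * p)) := by
          gcongr
          exact (ENNReal.rpow_le_rpow (enorm_le_lintegral_fderiv_ray hu hsupp hx) hp0.le).trans
            (lintegral_Ioi_one_rpow_le hp hs1 hray)
      _ = _ := by
          rw [mul_assoc, ← lintegral_mul_const' _ _ ENNReal.ofReal_ne_top]
          congr 1
          refine setLIntegral_congr_fun measurableSet_Ioi fun t ht ↦ ?_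
          have ht0 : 0 < t := zero_lt_one.trans ht
          simp only [G]
          rw [ENNReal.ofReal_rpow_of_nonneg (by positivity) hp0.le,
            ← ENNReal.ofReal_mul (by positivity), ← ENNReal.ofReal_mul (by positivity),
            ← ENNReal.ofReal_mul (by positivity), norm_smul, Real.norm_of_nonneg ht0.le,
            Real.mul_rpow (norm_nonneg _) hx0.le, Real.mul_rpow ht0.le hx0.le,
            Real.rpow_sub ht0, hexp]
          congr 1
          field_simp
  have hjoint : Measurable (Function.uncurry fun (x : E) (t : ℝ) ↦
      ENNReal.ofReal (t ^ (s * (p - 1) - (lam + 1) * p)) * G (t • x)) := by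
    have : Measurable fun z : E × ℝ ↦ G (z.2 • z.1) :=
      hG.comp (continuous_snd.smul continuous_fst).measurable
    exact Measurable.mul (by fun_prop) this
  calc ∫⁻ x, ENNReal.ofReal (|u x| ^ p * ‖x‖ ^ (lam * p)) ∂μ
      ≤ ∫⁻ x, (C ^ (p - 1) * ∫⁻ t in Ioi (1 : ℝ),
          ENNReal.ofReal (t ^ (s * (p - 1) - (lam + 1) * p)) * G (t • x)) ∂μ :=
        lintegral_mono_ae hpt
    _ = C ^ (p - 1) * ∫⁻ t in Ioi (1 : ℝ), (∫⁻ x,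
          ENNReal.ofReal (t ^ (s * (p - 1) - (lam + 1) * p)) * G (t • x) ∂μ) := by
        rw [lintegral_const_mul' _ _
          (ENNReal.rpow_ne_top_of_nonneg (by linarith) ENNReal.ofReal_ne_top),
          lintegral_lintegral_swap hjoint.aemeasurable]
    _ = C ^ (p - 1) * ∫⁻ t in Ioi (1 : ℝ), ENNReal.ofReal (t ^ (-s)) * ∫⁻ x, G x ∂μ := by
        congr 1
        refine setLIntegral_congr_fun measurableSet_Ioi fun t ht ↦ ?_
        have ht0 : 0 < t := zero_lt_one.trans ht
        rw [lintegral_const_mul' _ _ ENNReal.ofReal_ne_top, lintegral_comp_pos_smul μ hG ht0,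
          ← mul_assoc, ← ENNReal.ofReal_mul (by positivity), ← Real.rpow_add ht0]
        congr 3
        rw [hs]
        field_simp
        ring
    _ = C ^ p * ∫⁻ x, G x ∂μ := by
        rw [lintegral_mul_const _ (by fun_prop), lintegral_Ioi_one_rpow_neg hs1, ← mul_assoc]
        have hC0 : C ≠ 0 := by
          have : 0 < 1 / (s - 1) := one_div_pos.2 (by linarith)
          simpa [C] using this
        congr 1
        change C ^ (p - 1) * C = C ^ p
        have h := ENNReal.rpow_add (p - 1) 1 hC0 ENNReal.ofReal_ne_top
        rw [sub_add_cancel, ENNReal.rpow_one] at h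
        exact h.symm

/-- The weighted gradient of a `C¹` function with bounded support is integrable. -/
lemma integrable_fderiv_rpow_mul_norm_rpow [Nontrivial E] {p a : ℝ} (hp : 0 < p)
    (ha : -(finrank ℝ E : ℝ) < a) {u : E → ℝ} (hu : ContDiff ℝ 1 u) {R : ℝ}
    (hsupp : ∀ x, x ∉ Metric.ball (0 : E) R → u x = 0) :
    Integrable (fun x ↦ ‖fderiv ℝ u x‖ ^ p * ‖x‖ ^ a) μ := by
  have hcont := hu.continuous_fderiv one_ne_zero
  have hmeas : Measurable fun x ↦ ‖fderiv ℝ u x‖ := hcont.norm.measurable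
  have htsupport : tsupport u ⊆ Metric.closedBall 0 R :=
    closure_minimal (fun x hx ↦ Metric.ball_subset_closedBall (not_imp_comm.1 (hsupp x) hx))
      Metric.isClosed_closedBall
  have hcs : HasCompactSupport u := (isCompact_closedBall 0 R).of_isClosed_subset
    (isClosed_tsupport u) htsupport
  obtain ⟨M, hM⟩ := hcont.bounded_above_of_compact_support (hcs.fderiv ℝ)
  have hloc : IntegrableOn (fun x ↦ ‖fderiv ℝ u x‖ ^ p * ‖x‖ ^ a) (Metric.ball 0 (R + 1)) μ := by
    refine integrableOn_ball_of_norm_le_rpow (C := M ^ p) (α := -a) finrank_pos (by linarith)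
      (.of_forall fun x ↦ ?_) (Measurable.aestronglyMeasurable (by fun_prop))
    rw [neg_neg, Real.norm_of_nonneg (by positivity)]
    gcongr
    exact hM x
  rw [← integrableOn_iff_integrable_of_support_subset (s := Metric.ball 0 (R + 1))]
  · exact hloc
  · intro x hx
    have hfd : fderiv ℝ u x ≠ 0 := fun h ↦ hx (by simp [h, Real.zero_rpow hp.ne'])
    have := htsupport (support_fderiv_subset ℝ hfd)
    exact Metric.closedBall_subset_ball (by linarith) this

end Haar

/-- **Hardy's inequality.** Let `n ∈ ℕ`, `1 < p < ∞`, and `λ > -n/p`. Then every continuously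
differentiable function `u : ℝⁿ → ℝ` vanishing outside some ball `B_R` (`R > 0`) satisfies
`(∫ |u(x)|^p |x|^{λp} dx)^{1/p} ≤ (p / (λ + n/p)) (∫ ‖Du(x)‖^p |x|^{(λ+1)p} dx)^{1/p}`. -/
theorem hardy_inequality (n : ℕ) (hn : 0 < n) (p lam : ℝ) (hp : 1 < p)
    (hlam : -(n / p) < lam)
    (u : EuclideanSpace ℝ (Fin n) → ℝ) (hu : ContDiff ℝ 1 u)
    (R : ℝ) (hR : 0 < R)
    (hsupp : ∀ x : EuclideanSpace ℝ (Fin n), x ∉ Metric.ball 0 R → u x = 0) :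
    (∫ x : EuclideanSpace ℝ (Fin n), |u x| ^ p * ‖x‖ ^ (lam * p)) ^ (1 / p) ≤
      (p / (lam + n / p)) *
        (∫ x : EuclideanSpace ℝ (Fin n), ‖fderiv ℝ u x‖ ^ p * ‖x‖ ^ ((lam + 1) * p)) ^ (1 / p) := by
  have hp0 : 0 < p := by linarith
  have hc : 0 < lam + n / p := by linarith
  have hdim : finrank ℝ (EuclideanSpace ℝ (Fin n)) = n := finrank_euclideanSpace_fin
  have : Nontrivial (EuclideanSpace ℝ (Fin n)) :=
    Module.nontrivial_of_finrank_pos (R := ℝ) (hdim.symm ▸ hn)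
  have hint := integrable_fderiv_rpow_mul_norm_rpow volume (a := (lam + 1) * p) hp0
    (by
      have : 0 < (lam + n / p) * p := mul_pos hc hp0
      rw [add_mul, div_mul_cancel₀ _ hp0.ne'] at this
      rw [hdim]
      linarith) hu hsupp
  have hmain := lintegral_hardy_inequality volume hp (by rwa [hdim]) hu hsupp
  rw [hdim, ENNReal.ofReal_rpow_of_pos (by positivity), ← ofReal_integral_eq_lintegral_ofReal hint
    (.of_forall fun x ↦ by positivity), ← ENNReal.ofReal_mul (by positivity)] at hmain
  have hu_meas : Measurable u := hu.continuous.measurable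
  have hle : ∫ x, |u x| ^ p * ‖x‖ ^ (lam * p) ≤ (1 / (lam + n / p)) ^ p *
      ∫ x, ‖fderiv ℝ u x‖ ^ p * ‖x‖ ^ ((lam + 1) * p) := by
    rw [integral_eq_lintegral_of_nonneg_ae (.of_forall fun x ↦ by positivity)
      (Measurable.aestronglyMeasurable (by fun_prop))]
    exact ENNReal.toReal_le_of_le_ofReal (by positivity) hmain
  calc _ ≤ ((1 / (lam + n / p)) ^ p *
        ∫ x, ‖fderiv ℝ u x‖ ^ p * ‖x‖ ^ ((lam + 1) * p)) ^ (1 / p) :=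
        Real.rpow_le_rpow (by positivity) hle (by positivity)
    _ = 1 / (lam + n / p) *
        (∫ x, ‖fderiv ℝ u x‖ ^ p * ‖x‖ ^ ((lam + 1) * p)) ^ (1 / p) := by
        rw [Real.mul_rpow (by positivity) (by positivity), one_div p,
          Real.rpow_rpow_inv (by positivity) hp0.ne']
    _ ≤ _ := by gcongr
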